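/- There is a universal constant c > 0 such that for every d ≥ 5, n = 4d − 15, and 0 < σ ≤ 1/(360·d·√(log n)), there exist a two-dimensional linear subspace W ⊂ ℝ^d and points ā₁,…,ā_n ∈ ℝ^d with ‖ā_i‖₁ ≤ 1 for all i, such that if a₁,…,a_n are independent with a_i ∼ N(ā_i, σ²I_d), then with probability at least 1 − (n choose d)^{−1} the polygon conv(a₁,…,a_n) ∩ W has at least c·min( 1/√(d·σ·√(log n)), 2^d ) edges. -/

import Mathlib

open MeasureTheory Set
open scoped ENNReal ProbabilityTheory Pointwise RealInnerProductSpace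

noncomputable section

abbrev Euc (d : ℕ) := EuclideanSpace ℝ (Fin d)

/-- Number of edges (one-dimensional exposed faces) of a set. -/
def edgeCount {d : ℕ} (S : Set (Euc d)) : ℕ :=
  Set.ncard {F : Set (Euc d) | IsExposed ℝ S F ∧ Module.finrank ℝ (vectorSpan ℝ F) = 1}

/-- Density of the `d`-dimensional Gaussian with mean `m` and covariance `σ² I`. -/
def gaussPdf (d : ℕ) (m : Euc d) (σ : ℝ) (x : Euc d) : ℝ :=
  (Real.sqrt (2 * Real.pi * σ ^ 2))⁻¹ ^ d * Real.exp (-‖x - m‖ ^ 2 / (2 * σ ^ 2))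

/-- Joint law of `n` independent points in `ℝ^d`, the `i`-th having density `f i`. -/
def productDensityMeasure {n d : ℕ} (f : Fin n → Euc d → ℝ) :
    Measure (Fin n → Euc d) :=
  volume.withDensity fun ω => ENNReal.ofReal (∏ i, f i (ω i))

/-- Joint law of `n` independent Gaussian points `a_i ∼ N(m i, σ² I_d)`. -/
def jointGaussian (n d : ℕ) (m : Fin n → Euc d) (σ : ℝ) : Measure (Fin n → Euc d) :=
  productDensityMeasure fun i => gaussPdf d (m i) σ

/-- The `ℓ₁` norm on `ℝ^d`. -/
def l1norm {d : ℕ} (x : Euc d) : ℝ := ∑ i, |x i|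

theorem gaussPdf_nonneg (d : ℕ) (m : Euc d) (σ : ℝ) (x : Euc d) : 0 ≤ gaussPdf d m σ x := by
  unfold gaussPdf; positivity

theorem integrable_exp_neg_mul_norm_sub_sq {d : ℕ} (m : Euc d) {b : ℝ} (hb : 0 < b) :
    Integrable (fun x : Euc d => Real.exp (-b * ‖x - m‖ ^ 2)) := by
  have h : Integrable (fun x : Euc d => Real.exp (-b * ‖x‖ ^ 2)) := by
    refine (GaussianFourier.integrable_cexp_neg_mul_sq_norm_add (V := Euc d) (b := (b : ℂ))
      (by simpa using hb) 0 0).norm.congr (.of_forall fun x => ?_)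
    simp only [Complex.norm_exp]
    norm_cast
    simp
  exact h.comp_sub_right m

theorem integral_exp_neg_mul_norm_sub_sq {d : ℕ} (m : Euc d) {b : ℝ} (hb : 0 < b) :
    ∫ x : Euc d, Real.exp (-b * ‖x - m‖ ^ 2) = Real.sqrt (Real.pi / b) ^ d := by
  rw [integral_sub_right_eq_self (fun x : Euc d => Real.exp (-b * ‖x‖ ^ 2)) m,
    GaussianFourier.integral_rexp_neg_mul_sq_norm hb, finrank_euclideanSpace_fin, Real.sqrt_eq_rpow,
    ← Real.rpow_natCast, ← Real.rpow_mul (by positivity)]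
  ring_nf

theorem gaussPdf_eq {d : ℕ} (m : Euc d) (σ : ℝ) (x : Euc d) :
    gaussPdf d m σ x =
      (Real.sqrt (2 * Real.pi * σ ^ 2))⁻¹ ^ d *
        Real.exp (-(1 / (2 * σ ^ 2)) * ‖x - m‖ ^ 2) := by
  unfold gaussPdf
  congr 2
  ring

theorem integrable_gaussPdf {d : ℕ} (m : Euc d) {σ : ℝ} (hσ : 0 < σ) :
    Integrable (gaussPdf d m σ) := by
  simp_rw [funext (gaussPdf_eq m σ)]
  exact (integrable_exp_neg_mul_norm_sub_sq m (by positivity)).const_mul _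

theorem integral_gaussPdf {d : ℕ} (m : Euc d) {σ : ℝ} (hσ : 0 < σ) :
    ∫ x, gaussPdf d m σ x = 1 := by
  simp_rw [gaussPdf_eq m σ]
  rw [integral_const_mul, integral_exp_neg_mul_norm_sub_sq m (by positivity), ← mul_pow,
    show Real.pi / (1 / (2 * σ ^ 2)) = 2 * Real.pi * σ ^ 2 by field_simp,
    inv_mul_cancel₀ (by positivity), one_pow]

/-- Chernoff bound for the norm of a Gaussian vector. -/
theorem one_sub_le_setIntegral_gaussPdf {d : ℕ} (m : Euc d) {σ r : ℝ} (hσ : 0 < σ) (hr : 0 ≤ r) :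
    1 - Real.sqrt 2 ^ d * Real.exp (-r ^ 2 / (4 * σ ^ 2)) ≤
      ∫ x, (Metric.closedBall m r).indicator (gaussPdf d m σ) x := by
  have hball : MeasurableSet (Metric.closedBall m r) := measurableSet_closedBall
  have hintegrable := integrable_gaussPdf m hσ
  have hsplit : ∫ x, (Metric.closedBall m r).indicator (gaussPdf d m σ) x =
      1 - ∫ x, (Metric.closedBall m r)ᶜ.indicator (gaussPdf d m σ) x := by
    rw [integral_indicator hball, integral_indicator hball.compl, ← integral_gaussPdf m hσ,
      ← integral_add_compl hball hintegrable]
    ring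
  set A := (Real.sqrt (2 * Real.pi * σ ^ 2))⁻¹ ^ d * Real.exp (-r ^ 2 / (4 * σ ^ 2)) with hA
  have htail : ∫ x, (Metric.closedBall m r)ᶜ.indicator (gaussPdf d m σ) x ≤
      ∫ x, A * Real.exp (-(1 / (4 * σ ^ 2)) * ‖x - m‖ ^ 2) := by
    refine integral_mono (hintegrable.indicator hball.compl)
      ((integrable_exp_neg_mul_norm_sub_sq m (by positivity)).const_mul _) fun x => ?_
    refine Set.indicator_apply_le' (fun hx => ?_) (fun _ => by positivity)
    have hx' : r < ‖x - m‖ := by simpa [dist_eq_norm] using hx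
    rw [gaussPdf_eq, hA, mul_assoc (_ ^ d), ← Real.exp_add]
    gcongr
    have h2 : r ^ 2 ≤ ‖x - m‖ ^ 2 := by gcongr
    have : -(1 / (2 * σ ^ 2)) * ‖x - m‖ ^ 2 =
      -‖x - m‖ ^ 2 / (4 * σ ^ 2) + -(1 / (4 * σ ^ 2)) * ‖x - m‖ ^ 2 := by field_simp; ring
    rw [this]
    gcongr
  rw [hsplit]
  refine sub_le_sub_left (htail.trans_eq ?_) 1
  rw [integral_const_mul, integral_exp_neg_mul_norm_sub_sq m (by positivity), hA,
    mul_right_comm, ← mul_pow,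
    show Real.pi / (1 / (4 * σ ^ 2)) = 2 * (2 * Real.pi * σ ^ 2) by field_simp; ring,
    Real.sqrt_mul (by norm_num : (0 : ℝ) ≤ 2), mul_left_comm, inv_mul_cancel₀ (by positivity),
    mul_one]

theorem jointGaussian_pi_closedBall {n d : ℕ} (m : Fin n → Euc d) {σ : ℝ} (hσ : 0 < σ) (r : ℝ) :
    jointGaussian n d m σ {ω | ∀ i, ω i ∈ Metric.closedBall (m i) r} =
      ENNReal.ofReal
        (∏ i, ∫ x, (Metric.closedBall (m i) r).indicator (gaussPdf d (m i) σ) x) := by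
  have hmeas : MeasurableSet {ω : Fin n → Euc d | ∀ i, ω i ∈ Metric.closedBall (m i) r} := by
    rw [Set.ofPred_forall]
    exact MeasurableSet.iInter fun i => measurable_pi_apply i measurableSet_closedBall
  rw [jointGaussian, productDensityMeasure, withDensity_apply _ hmeas,
    ← integral_fintype_prod_volume_eq_prod, ofReal_integral_eq_lintegral_ofReal,
    ← lintegral_indicator hmeas]
  · refine lintegral_congr fun ω => ?_
    by_cases h : ∀ i, ω i ∈ Metric.closedBall (m i) r
    · rw [Set.indicator_of_mem (by exact h)]
      congr 1
      exact Finset.prod_congr rfl fun i _ => (Set.indicator_of_mem (h i) _).symm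
    · rw [Set.indicator_of_notMem (by exact h)]
      push Not at h
      obtain ⟨i, hi⟩ := h
      rw [Finset.prod_eq_zero (Finset.mem_univ i) (Set.indicator_of_notMem hi _),
        ENNReal.ofReal_zero]
  · exact Integrable.fintype_prod fun i =>
      (integrable_gaussPdf (m i) hσ).indicator measurableSet_closedBall
  · exact .of_forall fun ω => Finset.prod_nonneg fun i _ =>
      Set.indicator_nonneg (fun x _ => gaussPdf_nonneg d (m i) σ x) _

theorem card_mul_choose_mul_tail_le_one {n d : ℕ} (hd : 4 ≤ d) (hn : n ≤ 4 * d) :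
    (n : ℝ) * n.choose d * (Real.sqrt 2 ^ d * Real.exp (-(25 * d / 4))) ≤ 1 := by
  have hnd : (n : ℝ) ≤ 2 ^ d := by
    have : 4 * d ≤ 2 ^ d := by
      clear hn
      induction d, hd using Nat.le_induction with
      | base => norm_num
      | succ k hk ih => rw [pow_succ]; omega
    exact_mod_cast hn.trans this
  have hchoose : (n.choose d : ℝ) ≤ 16 ^ d := by
    have : n.choose d ≤ 16 ^ d := by
      calc n.choose d ≤ 2 ^ n := Nat.choose_le_two_pow n d
        _ ≤ 2 ^ (4 * d) := Nat.pow_le_pow_right (by norm_num) hn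
        _ = 16 ^ d := by rw [pow_mul]; norm_num
    exact_mod_cast this
  have hsqrt : Real.sqrt 2 ≤ 2 := Real.sqrt_le_iff.2 ⟨by norm_num, by norm_num⟩
  have hexp : Real.exp (-(25 * d / 4)) ≤ (1 / 64) ^ d := by
    have h6 : Real.exp (-6) ≤ 1 / 64 := by
      rw [Real.exp_neg, one_div]
      have h2 : (2 : ℝ) ≤ Real.exp 1 := by linarith [Real.add_one_le_exp (1 : ℝ)]
      have h : (64 : ℝ) ≤ Real.exp 6 := by
        calc (64 : ℝ) = 2 ^ 6 := by norm_num
          _ ≤ Real.exp 1 ^ 6 := by gcongr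
          _ = Real.exp 6 := by rw [← Real.exp_nat_mul]; norm_num
      exact inv_anti₀ (by norm_num) h
    calc Real.exp (-(25 * d / 4)) ≤ Real.exp (d * (-6)) := by
          gcongr
          have : (0 : ℝ) ≤ d := by positivity
          linarith
      _ = Real.exp (-6) ^ d := Real.exp_nat_mul _ _
      _ ≤ (1 / 64) ^ d := by gcongr
  calc (n : ℝ) * n.choose d * (Real.sqrt 2 ^ d * Real.exp (-(25 * d / 4)))
      ≤ 2 ^ d * 16 ^ d * (2 ^ d * (1 / 64) ^ d) := by gcongr
    _ = 1 := by rw [← mul_pow, ← mul_pow, ← mul_pow]; norm_num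

/-- All the points are close to their means with probability at least `1 - (n choose d)⁻¹`. -/
theorem one_sub_inv_choose_le_jointGaussian {n d : ℕ} (hd : 4 ≤ d) (hdn : d ≤ n) (hn : n ≤ 4 * d)
    (m : Fin n → Euc d) {σ : ℝ} (hσ : 0 < σ) :
    1 - ((n.choose d : ℕ) : ℝ≥0∞)⁻¹ ≤
      jointGaussian n d m σ {ω | ∀ i, ω i ∈ Metric.closedBall (m i) (5 * (Real.sqrt d * σ))} := by
  rw [jointGaussian_pi_closedBall m hσ]
  have hC : (0 : ℝ) < n.choose d := by exact_mod_cast Nat.choose_pos hdn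
  have hcard := card_mul_choose_mul_tail_le_one hd hn
  set q := Real.sqrt 2 ^ d * Real.exp (-(25 * d / 4)) with hq
  have hq0 : 0 ≤ q := by positivity
  have hnq : n * q ≤ (n.choose d : ℝ)⁻¹ := by
    rw [← one_div, le_div_iff₀ hC]
    linarith
  have hn1 : (1 : ℝ) ≤ n := by exact_mod_cast (by omega : 1 ≤ n)
  have hq1 : q ≤ 1 := by
    have : (n.choose d : ℝ)⁻¹ ≤ 1 :=
      inv_le_one_of_one_le₀ (by exact_mod_cast Nat.choose_pos hdn)
    nlinarith
  have hball : ∀ i, 1 - q ≤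
      ∫ x, (Metric.closedBall (m i) (5 * (Real.sqrt d * σ))).indicator (gaussPdf d (m i) σ) x := by
    intro i
    refine le_trans (le_of_eq ?_) (one_sub_le_setIntegral_gaussPdf (m i) hσ (by positivity))
    rw [hq]
    congr 3
    rw [mul_pow, mul_pow, Real.sq_sqrt (by positivity)]
    field_simp
    ring
  have hprod : 1 - (n.choose d : ℝ)⁻¹ ≤ ∏ i,
      ∫ x, (Metric.closedBall (m i) (5 * (Real.sqrt d * σ))).indicator (gaussPdf d (m i) σ) x := by
    calc 1 - (n.choose d : ℝ)⁻¹ ≤ 1 + n * (-q) := by linarith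
      _ ≤ (1 + -q) ^ n := one_add_mul_le_pow (by linarith) n
      _ = ∏ _i : Fin n, (1 - q) := by simp [sub_eq_add_neg]
      _ ≤ _ := Finset.prod_le_prod (fun _ _ => by linarith) fun i _ => hball i
  calc (1 : ℝ≥0∞) - ((n.choose d : ℕ) : ℝ≥0∞)⁻¹ = ENNReal.ofReal (1 - (n.choose d : ℝ)⁻¹) := by
        rw [ENNReal.ofReal_sub _ (by positivity), ENNReal.ofReal_one,
          ENNReal.ofReal_inv_of_pos hC, ENNReal.ofReal_natCast]
    _ ≤ _ := ENNReal.ofReal_le_ofReal hprod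

theorem mem_convexHull_range_iff {ι E : Type*} [Fintype ι] [AddCommGroup E] [Module ℝ E]
    (a : ι → E) (p : E) :
    p ∈ convexHull ℝ (range a) ↔
      ∃ w : ι → ℝ, (∀ i, 0 ≤ w i) ∧ ∑ i, w i = 1 ∧ ∑ i, w i • a i = p := by
  classical
  constructor
  · intro hp
    have h : convexHull ℝ (range a) = Fintype.linearCombination ℝ a '' stdSimplex ℝ ι := by
      rw [← convexHull_rangle_single_eq_stdSimplex, LinearMap.image_convexHull, ← Set.range_comp]
      congr 2
      ext i
      simp [Fintype.linearCombination_apply, Pi.single_apply]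
    rw [h] at hp
    obtain ⟨w, hw, rfl⟩ := hp
    exact ⟨w, hw.1, hw.2, rfl⟩
  · rintro ⟨w, h0, h1, h⟩
    exact mem_convexHull_of_exists_fintype w a h0 h1 (fun i => mem_range_self i) h

/-- A point of an exposed face of `conv a ∩ W` forces all points of the section carried by the same
generators into the face. -/
theorem mem_exposed_of_support_eq {ι E : Type*} [Fintype ι] [AddCommGroup E] [Module ℝ E]
    [TopologicalSpace E] (a : ι → E) (W : Submodule ℝ E) (l : StrongDual ℝ E) {v w : ι → ℝ}
    (hv0 : ∀ i, 0 ≤ v i) (hv1 : ∑ i, v i = 1) (hvW : ∑ i, v i • a i ∈ W)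
    (hw0 : ∀ i, 0 ≤ w i) (hw1 : ∑ i, w i = 1) (hwW : ∑ i, w i • a i ∈ W)
    (hsupp : ∀ i, w i = 0 → v i = 0)
    (hmax : ∀ y ∈ convexHull ℝ (range a) ∩ W, l y ≤ l (∑ i, w i • a i)) :
    l (∑ i, w i • a i) ≤ l (∑ i, v i • a i) := by
  obtain ⟨ε, hε, hεw⟩ : ∃ ε : ℝ, 0 < ε ∧ ∀ i, ε * v i ≤ w i := by
    have hpos : ∀ i, ∃ ε : ℝ, 0 < ε ∧ ∀ ε' ≤ ε, ε' * v i ≤ w i := by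
      intro i
      rcases (hw0 i).eq_or_lt with h | h
      · exact ⟨1, one_pos, fun ε' _ => by rw [hsupp i h.symm, ← h, mul_zero]⟩
      · refine ⟨w i / (v i + 1), div_pos h (by linarith [hv0 i]), fun ε' hε' => ?_⟩
        have hv := hv0 i
        calc ε' * v i ≤ w i / (v i + 1) * v i := by gcongr
          _ ≤ w i := by
            rw [div_mul_eq_mul_div, div_le_iff₀ (by linarith)]
            nlinarith
    choose e he he' using hpos
    rcases isEmpty_or_nonempty ι with hι | hι
    · simp at hv1
    · obtain ⟨i₀, hi₀⟩ := Finite.exists_min e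
      exact ⟨e i₀, he i₀, fun i => he' i _ (hi₀ i)⟩
  set p := ∑ i, v i • a i with hp
  set p' := ∑ i, w i • a i with hp'
  have hmem : (1 + ε) • p' - ε • p ∈ convexHull ℝ (range a) ∩ W := by
    refine ⟨(mem_convexHull_range_iff a _).2 ⟨fun i => (1 + ε) * w i - ε * v i, ?_, ?_, ?_⟩,
      W.sub_mem (W.smul_mem _ hwW) (W.smul_mem _ hvW)⟩
    · intro i
      nlinarith [hεw i, hw0 i]
    · rw [Finset.sum_sub_distrib, ← Finset.mul_sum, ← Finset.mul_sum, hv1, hw1]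
      ring
    · simp only [sub_smul, mul_smul, Finset.sum_sub_distrib, ← Finset.smul_sum]
      rw [hp, hp']
  have h := hmax _ hmem
  rw [map_sub, map_smul, map_smul, smul_eq_mul, smul_eq_mul] at h
  nlinarith

theorem finite_setOf_isExposed {ι E : Type*} [Fintype ι] [AddCommGroup E] [Module ℝ E]
    [TopologicalSpace E] (a : ι → E) (W : Submodule ℝ E) :
    {F : Set E | IsExposed ℝ (convexHull ℝ (range a) ∩ W) F}.Finite := by
  let supports : Set E → Set (Set ι) := fun F =>
    {J | ∃ w : ι → ℝ, (∀ i, 0 ≤ w i) ∧ ∑ i, w i = 1 ∧ ∑ i, w i • a i ∈ F ∧ J = {i | w i = 0}}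
  have hsub : ∀ F G : Set E, IsExposed ℝ (convexHull ℝ (range a) ∩ W) F →
      IsExposed ℝ (convexHull ℝ (range a) ∩ W) G → supports F = supports G → F ⊆ G := by
    intro F G hF hG hFG p hp
    have hpS := hF.subset hp
    obtain ⟨v, hv0, hv1, rfl⟩ := (mem_convexHull_range_iff a p).1 hpS.1
    have hJ : {i | v i = 0} ∈ supports G := hFG ▸ ⟨v, hv0, hv1, hp, rfl⟩
    obtain ⟨w, hw0, hw1, hwG, hvw⟩ := hJ
    obtain ⟨l, rfl⟩ := hG ⟨_, hwG⟩
    refine ⟨hpS, fun y hy => (hwG.2 y hy).trans ?_⟩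
    exact mem_exposed_of_support_eq a W l hv0 hv1 hpS.2 hw0 hw1 hwG.1.2
      (fun i hi => (Set.ext_iff.1 hvw i).2 hi) hwG.2
  refine Set.Finite.of_injOn (f := supports) (t := Set.univ) (fun _ _ => mem_univ _) ?_
    Set.finite_univ
  intro F hF G hG h
  exact (hsub F G hF hG h).antisymm (hsub G F hG hF h.symm)

/-- The polar polyhedron of a finite family of points. -/
def polarSet {n d : ℕ} (a : Fin n → Euc d) : Set (Euc d) := {x | ∀ i, ⟪a i, x⟫ ≤ 1}

theorem inner_le_one_of_mem_convexHull {n d : ℕ} {a : Fin n → Euc d} {x y : Euc d}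
    (hx : x ∈ polarSet a) (hy : y ∈ convexHull ℝ (range a)) : ⟪x, y⟫ ≤ 1 := by
  have hconv : Convex ℝ {y : Euc d | ⟪x, y⟫ ≤ 1} :=
    convex_halfSpace_le (innerSL ℝ x).toLinearMap.isLinear 1
  refine convexHull_min ?_ hconv hy
  rintro _ ⟨i, rfl⟩
  rw [Set.mem_ofPred, real_inner_comm]
  exact hx i

theorem mem_convexHull_of_polarSet_bounded {n d : ℕ} (hn : 0 < n) {a : Fin n → Euc d} {M : ℝ}
    (hM : ∀ x ∈ polarSet a, ‖x‖ ≤ M) {y : Euc d} (hy : M * ‖y‖ < 1) :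
    y ∈ convexHull ℝ (range a) := by
  by_contra hyQ
  obtain ⟨f, u, hfu, huy⟩ := geometric_hahn_banach_closed_point (convex_convexHull ℝ (range a))
    ((Set.finite_range a).isCompact_convexHull (𝕜 := ℝ)).isClosed hyQ
  set x := (InnerProductSpace.toDual ℝ (Euc d)).symm f with hx
  have hf : ∀ z, f z = ⟪x, z⟫ := fun z => by simp [hx]
  have ha : ∀ i, ⟪a i, x⟫ < u := fun i => by
    rw [real_inner_comm, ← hf]
    exact hfu _ (subset_convexHull ℝ _ (mem_range_self i))
  rcases le_or_gt u 0 with hu | hu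
  · have hx0 : x ≠ 0 := by
      intro h0
      have := ha ⟨0, hn⟩
      rw [hf, h0, inner_zero_left] at huy
      rw [h0, inner_zero_right] at this
      linarith
    have hxn : 0 < ‖x‖ := norm_pos_iff.2 hx0
    have hM0 : 0 ≤ M := (norm_nonneg _).trans (hM 0 fun i => by simp)
    have hmem : ((M + 1) / ‖x‖) • x ∈ polarSet a := fun i => by
      rw [inner_smul_right]
      have : 0 ≤ (M + 1) / ‖x‖ := by positivity
      nlinarith [ha i]
    have h := hM _ hmem
    rw [norm_smul, Real.norm_of_nonneg (by positivity), div_mul_cancel₀ _ hxn.ne'] at h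
    linarith
  · have hmem : u⁻¹ • x ∈ polarSet a := fun i => by
      rw [inner_smul_right, inv_mul_le_iff₀ hu]
      linarith [ha i]
    have h1 : 1 < ⟪u⁻¹ • x, y⟫ := by
      rw [inner_smul_left, ← hf]
      simpa [inv_mul_eq_div, one_lt_div hu] using huy
    have h2 := real_inner_le_norm (u⁻¹ • x) y
    have h3 := mul_le_mul_of_nonneg_right (hM _ hmem) (norm_nonneg y)
    linarith

theorem exists_supporting_polar_point {n d : ℕ} (hn : 0 < n) {a : Fin n → Euc d} {M : ℝ}
    (hM : ∀ x ∈ polarSet a, ‖x‖ ≤ M) {u : Euc d} (hu : u ≠ 0) :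
    ∃ t : ℝ, 0 < t ∧ t • u ∈ convexHull ℝ (range a) ∧
      ∃ x ∈ polarSet a, ⟪x, t • u⟫ = 1 := by
  set Q := convexHull ℝ (range a) with hQ
  have hconv : Convex ℝ Q := convex_convexHull ℝ _
  have hcomp : IsCompact Q := ((Set.finite_range a).isCompact_convexHull (𝕜 := ℝ))
  have hM0 : 0 ≤ M := (norm_nonneg _).trans (hM 0 fun i => by simp)
  have hnhds : Q ∈ nhds (0 : Euc d) := by
    refine Metric.mem_nhds_iff.2 ⟨1 / (M + 1), by positivity, fun y hy => ?_⟩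
    refine mem_convexHull_of_polarSet_bounded hn hM ?_
    rw [mem_ball_zero_iff, lt_div_iff₀ (by positivity)] at hy
    nlinarith [norm_nonneg y]
  have hg : 0 < gauge Q u :=
    (gauge_pos (absorbent_nhds_zero hnhds)
      (NormedSpace.isVonNBounded_of_isBounded ℝ hcomp.isBounded)).2 hu
  set t := (gauge Q u)⁻¹ with ht
  have hfr : t • u ∈ frontier Q := by
    rw [← gauge_eq_one_iff_mem_frontier hconv hnhds, gauge_smul_of_nonneg (by positivity),
      smul_eq_mul, ht, inv_mul_cancel₀ hg.ne']
  have h0 : (0 : Euc d) ∈ interior Q := mem_interior_iff_mem_nhds.2 hnhds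
  obtain ⟨f, hf⟩ := geometric_hahn_banach_open_point hconv.interior isOpen_interior hfr.2
  have hfpos : 0 < f (t • u) := by simpa using hf 0 h0
  have hle : ∀ y ∈ Q, f y ≤ f (t • u) := by
    intro y hy
    have hy' : y ∈ closure (interior Q) := by
      rw [hconv.closure_interior_eq_closure_of_nonempty_interior ⟨0, h0⟩]
      exact subset_closure hy
    exact closure_minimal (fun z hz => (hf z hz).le) (isClosed_Iic.preimage f.continuous) hy'
  refine ⟨t, by positivity, hcomp.isClosed.frontier_subset hfr,
    (f (t • u))⁻¹ • (InnerProductSpace.toDual ℝ (Euc d)).symm f, fun i => ?_, ?_⟩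
  · rw [real_inner_comm, inner_smul_left, InnerProductSpace.toDual_symm_apply]
    simp only [conj_trivial]
    rw [inv_mul_le_iff₀ hfpos, mul_one]
    exact hle _ (subset_convexHull ℝ _ (mem_range_self i))
  · rw [inner_smul_left, InnerProductSpace.toDual_symm_apply]
    simp only [conj_trivial]
    exact inv_mul_cancel₀ hfpos.ne'

/-- `x` maximizes the functional `u` over the polar set of `a`. -/
def IsPolarMax {n d : ℕ} (a : Fin n → Euc d) (u x : Euc d) : Prop :=
  x ∈ polarSet a ∧ ∀ x' ∈ polarSet a, ⟪x', u⟫ ≤ ⟪x, u⟫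

theorem isPolarMax_of_inner_smul_eq_one {n d : ℕ} {a : Fin n → Euc d} {u x : Euc d} {t : ℝ}
    (ht : 0 < t) (htu : t • u ∈ convexHull ℝ (range a)) (hx : x ∈ polarSet a)
    (h : ⟪x, t • u⟫ = 1) : IsPolarMax a u x := by
  refine ⟨hx, fun x' hx' => ?_⟩
  have h' := inner_le_one_of_mem_convexHull hx' htu
  rw [← h, inner_smul_right, inner_smul_right] at h'
  exact le_of_mul_le_mul_left h' ht

theorem isExposed_inner_eq_one {n d : ℕ} {a : Fin n → Euc d} (W : Submodule ℝ (Euc d))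
    {x p : Euc d} (hx : x ∈ polarSet a) (hp : p ∈ convexHull ℝ (range a) ∩ W)
    (hxp : ⟪x, p⟫ = 1) :
    IsExposed ℝ (convexHull ℝ (range a) ∩ W) {y ∈ convexHull ℝ (range a) ∩ W | ⟪x, y⟫ = 1} := by
  refine fun _ => ⟨innerSL ℝ x, ?_⟩
  ext y
  simp only [innerSL_apply_apply, Set.mem_sep_iff]
  refine and_congr_right fun hy => ⟨fun h z hz => ?_, fun h => ?_⟩
  · rw [h]
    exact inner_le_one_of_mem_convexHull hx hz.1
  · exact (inner_le_one_of_mem_convexHull hx hy.1).antisymm (hxp ▸ h p hp)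

theorem finrank_vectorSpan_inner_eq_one_le {d : ℕ} {W : Submodule ℝ (Euc d)}
    (hW : Module.finrank ℝ W = 2) {S : Set (Euc d)} (hSW : S ⊆ W) {x p : Euc d} (hp : p ∈ W)
    (hxp : ⟪x, p⟫ = 1) : Module.finrank ℝ (vectorSpan ℝ {y ∈ S | ⟪x, y⟫ = 1}) ≤ 1 := by
  have hle : vectorSpan ℝ {y ∈ S | ⟪x, y⟫ = 1} ≤ W ⊓ (innerSL ℝ x).toLinearMap.ker := by
    rw [vectorSpan_def, Submodule.span_le]
    rintro _ ⟨y, hy, z, hz, rfl⟩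
    refine ⟨W.sub_mem (hSW hy.1) (hSW hz.1), ?_⟩
    simp only [vsub_eq_sub, SetLike.mem_coe, LinearMap.mem_ker, ContinuousLinearMap.coe_coe,
      innerSL_apply_apply, inner_sub_right]
    rw [hy.2, hz.2, sub_self]
  have hlt : W ⊓ (innerSL ℝ x).toLinearMap.ker < W := by
    refine inf_le_left.lt_of_ne fun h => ?_
    have hp' : p ∈ W ⊓ (innerSL ℝ x).toLinearMap.ker := h.symm ▸ hp
    have h0 : ⟪x, p⟫ = 0 := by simpa using hp'.2
    linarith
  have h1 := Submodule.finrank_mono hle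
  have h2 := Submodule.finrank_lt_finrank_of_lt hlt
  omega

/-- If maximizers over the polar set in the directions `p₀ + s • q₀`, `s ∈ [0, 1]`, determine `s`
up to an error smaller than `1 / (2 N)`, then the section has at least `N` edges. -/
theorem le_edgeCount {n d : ℕ} (hn : 0 < n) {a : Fin n → Euc d} {M : ℝ}
    (hM : ∀ x ∈ polarSet a, ‖x‖ ≤ M) {p₀ q₀ : Euc d} (hpq : LinearIndependent ℝ ![p₀, q₀])
    {N : ℕ} (hsep : N ≤ 1 ∨ ∀ s ∈ Icc (0 : ℝ) 1, ∀ s' ∈ Icc (0 : ℝ) 1, ∀ x,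
      IsPolarMax a (p₀ + s • q₀) x → IsPolarMax a (p₀ + s' • q₀) x → |s - s'| * (2 * N) < 1) :
    N ≤ edgeCount (convexHull ℝ (range a) ∩ (Submodule.span ℝ {p₀, q₀} : Submodule ℝ (Euc d))) := by
  set W := Submodule.span ℝ {p₀, q₀} with hWdef
  set Q := convexHull ℝ (range a) with hQ
  have hp₀ : p₀ ∈ W := Submodule.subset_span (by simp)
  have hq₀ : q₀ ∈ W := Submodule.subset_span (by simp)
  have hW : Module.finrank ℝ W = 2 := by
    have h := finrank_span_eq_card hpq
    rwa [Matrix.range_cons, Matrix.range_cons, Matrix.range_empty, union_empty,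
      ← Set.insert_eq, Fintype.card_fin] at h
  set u : ℝ → Euc d := fun s => p₀ + s • q₀ with hu
  have huW : ∀ s, u s ∈ W := fun s => W.add_mem hp₀ (W.smul_mem _ hq₀)
  have hpair := LinearIndependent.pair_iff.1 hpq
  have hu0 : ∀ s, u s ≠ 0 := fun s h => by
    have := (hpair 1 s (by simpa [hu] using h)).1
    norm_num at this
  choose t ht htQ x hx hxt using fun s => exists_supporting_polar_point hn hM (hu0 s)
  have hinj : ∀ s s', t s • u s = t s' • u s' → s = s' := by
    intro s s' h
    have h' : (t s - t s') • p₀ + (t s * s - t s' * s') • q₀ = 0 := by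
      rw [← sub_eq_zero] at h
      rw [← h]
      simp only [hu]
      module
    obtain ⟨h1, h2⟩ := hpair _ _ h'
    have h3 : t s = t s' := by linarith
    rw [← h3, ← mul_sub] at h2
    rcases mul_eq_zero.1 h2 with h4 | h4
    · exact absurd h4 (ht s).ne'
    · linarith
  set T := Q ∩ (W : Set (Euc d)) with hT
  set F : ℝ → Set (Euc d) := fun s => {y ∈ T | ⟪x s, y⟫ = 1} with hF
  have hpT : ∀ s, t s • u s ∈ T := fun s => ⟨htQ s, W.smul_mem _ (huW s)⟩
  have hexp : ∀ s, IsExposed ℝ T (F s) := fun s =>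
    isExposed_inner_eq_one W (hx s) (hpT s) (hxt s)
  have hfin := finite_setOf_isExposed a W
  have hbad : {s | IsExposed ℝ T {t s • u s}}.Finite := by
    refine Set.Finite.of_injOn (f := fun s => ({t s • u s} : Set (Euc d))) (t := _)
      (fun s hs => hs) ?_ hfin
    intro s _ s' _ h
    exact hinj s s' (Set.singleton_injective h)
  have hedge : ∀ s, ¬ IsExposed ℝ T {t s • u s} →
      Module.finrank ℝ (vectorSpan ℝ (F s)) = 1 := by
    intro s hs
    have hle := finrank_vectorSpan_inner_eq_one_le hW (S := T) inter_subset_right (hpT s).2 (hxt s)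
    refine hle.antisymm (Nat.one_le_iff_ne_zero.2 fun h0 => hs ?_)
    rw [Submodule.finrank_eq_zero, vectorSpan_eq_bot_iff_subsingleton] at h0
    have : F s = {t s • u s} := h0.eq_singleton_of_mem ⟨hpT s, hxt s⟩
    exact this ▸ hexp s
  have hgood : ∀ i : Fin N, ∃ s ∈ Icc ((i : ℝ) / N) ((i : ℝ) / N + 1 / (2 * N)),
      ¬ IsExposed ℝ T {t s • u s} := by
    intro i
    have hN : (0 : ℝ) < N := by exact_mod_cast i.pos
    have hinf : (Icc ((i : ℝ) / N) ((i : ℝ) / N + 1 / (2 * N))).Infinite :=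
      Set.Icc_infinite (by linarith [show (0 : ℝ) < 1 / (2 * N) by positivity])
    obtain ⟨s, hs, hs'⟩ := (hinf.sdiff hbad).nonempty
    exact ⟨s, hs, hs'⟩
  choose s hs hsgood using hgood
  have hIcc : ∀ i, s i ∈ Icc (0 : ℝ) 1 := by
    intro i
    have hN : (0 : ℝ) < N := by exact_mod_cast i.pos
    have hi : (i : ℝ) + 1 ≤ N := by exact_mod_cast i.2
    refine ⟨le_trans (by positivity) (hs i).1, (hs i).2.trans ?_⟩
    rw [div_add_div _ _ hN.ne' (by positivity), div_le_one (by positivity)]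
    nlinarith
  have hFinj : Function.Injective fun i => F (s i) := by
    intro i j hij
    by_contra hne
    rcases hsep with hN1 | hsep
    · exact hne (Fin.ext (by omega))
    have hN : (0 : ℝ) < N := by exact_mod_cast i.pos
    have hmem : t (s j) • u (s j) ∈ F (s i) := by
      rw [show F (s i) = F (s j) from hij]
      exact ⟨hpT _, hxt _⟩
    have h := hsep _ (hIcc i) _ (hIcc j) (x (s i))
      (isPolarMax_of_inner_smul_eq_one (ht _) (htQ _) (hx _) (hxt _))
      (isPolarMax_of_inner_smul_eq_one (ht _) (htQ _) (hx _) hmem.2)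
    have hgap : ∀ k l : Fin N, k < l → 1 ≤ (s l - s k) * (2 * N) := by
      intro k l hkl
      have hkl' : (k : ℝ) + 1 ≤ l := by exact_mod_cast hkl
      have h1 := (hs k).2
      have h2 := (hs l).1
      have h3 : ((l : ℝ) / N - ((k : ℝ) / N + 1 / (2 * N))) * (2 * N) = 2 * (l - k) - 1 := by
        field_simp
        ring
      have h4 : ((l : ℝ) / N - ((k : ℝ) / N + 1 / (2 * N))) * (2 * N) ≤ (s l - s k) * (2 * N) := by
        gcongr
      linarith
    rcases lt_or_gt_of_ne hne with hlt | hlt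
    · have := hgap i j hlt
      rw [abs_sub_comm] at h
      have := mul_le_mul_of_nonneg_right (le_abs_self (s j - s i)) (by positivity : 0 ≤ 2 * (N : ℝ))
      linarith
    · have := hgap j i hlt
      have := mul_le_mul_of_nonneg_right (le_abs_self (s i - s j)) (by positivity : 0 ≤ 2 * (N : ℝ))
      linarith
  calc N = (Set.range fun i => F (s i)).ncard := by
        rw [← Set.image_univ, Set.ncard_image_of_injective _ hFinj, Set.ncard_univ, Nat.card_fin]
    _ ≤ _ := Set.ncard_le_ncard
        (by rintro _ ⟨i, rfl⟩; exact ⟨hexp _, hedge _ (hsgood i)⟩)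
        (hfin.subset fun G hG => hG.1)

theorem real_inner_eq_sum {d : ℕ} (x y : Euc d) : ⟪x, y⟫ = ∑ k, x k * y k := by
  rw [PiLp.inner_apply]
  exact Finset.sum_congr rfl fun k _ => by simp [mul_comm]

theorem abs_inner_le_l1norm_mul {d : ℕ} (g x : Euc d) {B : ℝ} (hB : ∀ k, |x k| ≤ B) :
    |⟪g, x⟫| ≤ l1norm g * B := by
  rw [real_inner_eq_sum, l1norm, Finset.sum_mul]
  refine (Finset.abs_sum_le_sum_abs _ _).trans (Finset.sum_le_sum fun k _ => ?_)
  rw [abs_mul]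
  exact mul_le_mul_of_nonneg_left (hB k) (abs_nonneg _)

theorem l1norm_le_sqrt_mul_norm {d : ℕ} (g : Euc d) : l1norm g ≤ Real.sqrt d * ‖g‖ := by
  rw [EuclideanSpace.norm_eq, ← Real.sqrt_mul (by positivity)]
  refine Real.le_sqrt_of_sq_le ?_
  have h := sq_sum_le_card_mul_sum_sq (s := (Finset.univ : Finset (Fin d))) (f := fun k => |g k|)
  simpa [l1norm] using h

theorem l1norm_sub_le {d : ℕ} (x y : Euc d) : l1norm (x - y) ≤ l1norm x + l1norm y := by
  rw [l1norm, l1norm, l1norm, ← Finset.sum_add_distrib]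
  exact Finset.sum_le_sum fun k _ => abs_sub (x k) (y k)

theorem l1norm_add_le {d : ℕ} (x y : Euc d) : l1norm (x + y) ≤ l1norm x + l1norm y := by
  rw [l1norm, l1norm, l1norm, ← Finset.sum_add_distrib]
  exact Finset.sum_le_sum fun k _ => abs_add_le (x k) (y k)

theorem l1norm_single {d : ℕ} (k : Fin d) (c : ℝ) :
    l1norm (EuclideanSpace.single k c) = |c| := by
  rw [l1norm, Finset.sum_eq_single k] <;> simp +contextual

theorem l1norm_sum_le {d : ℕ} {ι : Type*} (s : Finset ι) (f : ι → Euc d) :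
    l1norm (∑ i ∈ s, f i) ≤ ∑ i ∈ s, l1norm (f i) := by
  classical
  induction s using Finset.induction_on with
  | empty => simp [l1norm]
  | insert i s hi ih =>
    rw [Finset.sum_insert hi, Finset.sum_insert hi]
    exact (l1norm_add_le _ _).trans (by gcongr)

theorem norm_le_of_forall_abs_le {d : ℕ} {x : Euc d} {B : ℝ} (hB0 : 0 ≤ B) (hB : ∀ k, |x k| ≤ B) :
    ‖x‖ ≤ d * B := by
  rw [EuclideanSpace.norm_eq]
  refine Real.sqrt_le_iff.2 ⟨by positivity, ?_⟩
  calc ∑ k, ‖x k‖ ^ 2 ≤ ∑ _k : Fin d, B ^ 2 := by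
        refine Finset.sum_le_sum fun k _ => ?_
        rw [Real.norm_eq_abs]
        exact pow_le_pow_left₀ (abs_nonneg _) (hB k) 2
    _ = d * B ^ 2 := by simp
    _ ≤ (d : ℝ) ^ 2 * B ^ 2 := by
        gcongr
        exact_mod_cast Nat.le_self_pow two_ne_zero d
    _ = (d * B) ^ 2 := by ring

theorem inv_smul_mem_polarSet {n d : ℕ} {a b : Fin n → Euc d} {δ B : ℝ}
    (hδ : ∀ i, l1norm (b i - a i) ≤ δ) (hδ0 : 0 ≤ δ) (hB0 : 0 ≤ B) {x : Euc d}
    (hx : x ∈ polarSet a) (hB : ∀ k, |x k| ≤ B) : (1 + δ * B)⁻¹ • x ∈ polarSet b := by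
  intro i
  rw [inner_smul_right, inv_mul_le_iff₀ (by positivity), mul_one]
  have h1 : ⟪b i, x⟫ = ⟪a i, x⟫ + ⟪b i - a i, x⟫ := by rw [inner_sub_left]; ring
  have h2 := (le_abs_self _).trans (abs_inner_le_l1norm_mul (b i - a i) x hB)
  have h3 := mul_le_mul_of_nonneg_right (hδ i) hB0
  linarith [hx i]

theorem abs_le_of_mem_polarSet_perturbed {n d : ℕ} {a b : Fin n → Euc d} {δ R : ℝ}
    (hδ : ∀ i, l1norm (b i - a i) ≤ δ) (hδ0 : 0 ≤ δ) (hδR : δ * R ≤ 1 / 2)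
    (hR : ∀ x ∈ polarSet a, ∀ k, |x k| ≤ R) {x : Euc d} (hx : x ∈ polarSet b) (k : Fin d) :
    |x k| ≤ 2 * R := by
  have : Nonempty (Fin d) := ⟨k⟩
  obtain ⟨k₀, hk₀⟩ := Finite.exists_max fun k => |x k|
  have hM0 : 0 ≤ |x k₀| := abs_nonneg _
  have hδ' : ∀ i, l1norm (a i - b i) ≤ δ := fun i => by
    have : l1norm (a i - b i) = l1norm (b i - a i) := by simp [l1norm, abs_sub_comm]
    exact this ▸ hδ i
  have h := hR _ (inv_smul_mem_polarSet hδ' hδ0 hM0 hx hk₀) k₀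
  rw [PiLp.smul_apply, smul_eq_mul, abs_mul, abs_of_pos (by positivity),
    inv_mul_le_iff₀ (by positivity)] at h
  have := hk₀ k
  simp only at this
  nlinarith

/-- Relaxed tent-map chains: the weighted sum is bounded by a parabola in the starting point. -/
theorem sum_tent_le {m : ℕ} (z : Fin (m + 1) → ℝ)
    (h₁ : ∀ j : Fin m, z j.succ ≤ 3 + 2 * z j.castSucc)
    (h₂ : ∀ j : Fin m, z j.succ ≤ 3 - 2 * z j.castSucc) (hlast : |z (Fin.last m)| ≤ 3) :
    (∀ j, |z j| ≤ 3) ∧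
      ∑ j : Fin m, (1 / 4) ^ (j.val + 1) * z j.succ ≤ 1 / 2 - z 0 ^ 2 / 6 + (1 / 4) ^ m := by
  induction m with
  | zero =>
    have h0 : |z 0| ≤ 3 := hlast
    refine ⟨fun j => by rwa [Fin.fin_one_eq_zero j], ?_⟩
    have := sq_le_sq' (abs_le.1 h0).1 (abs_le.1 h0).2
    simp only [Finset.univ_eq_empty, Finset.sum_empty, pow_zero]
    linarith
  | succ m ih =>
    obtain ⟨hb, hs⟩ := ih (fun j => z j.succ) (fun j => by simpa using h₁ j.succ)
      (fun j => by simpa using h₂ j.succ) (by simpa using hlast)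
    have h1 := h₁ 0
    have h2 := h₂ 0
    have h3 := abs_le.1 (hb 0)
    simp only [Fin.castSucc_zero] at h1 h2
    have hz0 : |z 0| ≤ 3 := abs_le.2 ⟨by linarith, by linarith⟩
    refine ⟨fun j => Fin.cases hz0 hb j, ?_⟩
    rw [Fin.sum_univ_succ]
    have hsum : ∑ j : Fin m, (1 / 4 : ℝ) ^ (j.succ.val + 1) * z j.succ.succ =
        1 / 4 * ∑ j : Fin m, (1 / 4) ^ (j.val + 1) * z j.succ.succ := by
      rw [Finset.mul_sum]
      refine Finset.sum_congr rfl fun j _ => ?_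
      rw [Fin.val_succ]
      ring
    rw [hsum]
    have hz1 : z (Fin.succ 0) + 2 * |z 0| ≤ 3 := by
      rcases abs_cases (z 0) with h | h <;> linarith [h.1]
    have hkey : z (Fin.succ 0) - z (Fin.succ 0) ^ 2 / 6 ≤ 3 / 2 - 2 * z 0 ^ 2 / 3 := by
      have := sq_abs (z 0)
      nlinarith [abs_nonneg (z 0)]
    simp only [Fin.val_zero, zero_add, pow_one]
    rw [pow_succ (1 / 4 : ℝ) m]
    linarith

/-- The tent map on `[-3, 3]`. -/
def tent (z : ℝ) : ℝ := 3 - 2 * |z|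

theorem abs_tent_iterate_le {s : ℝ} (hs : |s| ≤ 3) (j : ℕ) : |tent^[j] s| ≤ 3 := by
  induction j with
  | zero => exact hs
  | succ j ih =>
    rw [Function.iterate_succ_apply', tent, abs_le]
    constructor <;> linarith [abs_nonneg (tent^[j] s)]

theorem sum_tent_iterate (s : ℝ) (m : ℕ) :
    ∑ j ∈ Finset.range m, (1 / 4 : ℝ) ^ (j + 1) * tent^[j + 1] s =
      1 / 2 - s ^ 2 / 6 - (1 / 4) ^ m * (1 / 2 - (tent^[m] s) ^ 2 / 6) := by
  induction m with
  | zero => simp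
  | succ m ih =>
    rw [Finset.sum_range_succ, ih, Function.iterate_succ_apply', pow_succ]
    have h : (tent (tent^[m] s)) ^ 2 = 9 - 12 * |tent^[m] s| + 4 * (tent^[m] s) ^ 2 := by
      rw [tent, ← sq_abs (tent^[m] s)]
      ring
    rw [h]
    simp only [tent]
    ring

/-- The vectors whose polar polytope projects to an approximation of a parabolic region. -/
def chainVec (m : ℕ) : Fin m ⊕ Fin m ⊕ Fin 3 → Euc (m + 2)
  | .inl j => EuclideanSpace.single j.succ.succ (1 / 3) -
      EuclideanSpace.single j.castSucc.succ (2 / 3)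
  | .inr (.inl j) => EuclideanSpace.single j.succ.succ (1 / 3) +
      EuclideanSpace.single j.castSucc.succ (2 / 3)
  | .inr (.inr 0) => EuclideanSpace.single (Fin.last (m + 1)) (-1 / 3)
  | .inr (.inr 1) => EuclideanSpace.single 0 (1 / 2) -
      ∑ j : Fin m, EuclideanSpace.single j.succ.succ ((1 / 4) ^ (j.val + 1))
  | .inr (.inr 2) => EuclideanSpace.single 0 (-1)

theorem sum_quarter_pow_le (m : ℕ) : ∑ j : Fin m, (1 / 4 : ℝ) ^ (j.val + 1) ≤ 1 / 3 := by
  rw [Fin.sum_univ_eq_sum_range (fun j => (1 / 4 : ℝ) ^ (j + 1))]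
  have h : ∑ j ∈ Finset.range m, (1 / 4 : ℝ) ^ (j + 1) = 1 / 3 - (1 / 4) ^ m / 3 := by
    induction m with
    | zero => simp
    | succ m ih => rw [Finset.sum_range_succ, ih]; ring
  have : (0 : ℝ) ≤ (1 / 4) ^ m := by positivity
  linarith

theorem l1norm_chainVec_le (m : ℕ) (i : Fin m ⊕ Fin m ⊕ Fin 3) : l1norm (chainVec m i) ≤ 1 := by
  rcases i with j | j | j
  · refine (l1norm_sub_le _ _).trans ?_
    rw [l1norm_single, l1norm_single]
    norm_num [abs_of_pos]
  · refine (l1norm_add_le _ _).trans ?_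
    rw [l1norm_single, l1norm_single]
    norm_num [abs_of_pos]
  · fin_cases j
    · simp only [chainVec, l1norm_single]
      norm_num [abs_of_neg]
    · refine (l1norm_sub_le _ _).trans ?_
      have h := l1norm_sum_le Finset.univ fun j : Fin m =>
        (EuclideanSpace.single j.succ.succ ((1 / 4) ^ (j.val + 1)) : Euc (m + 2))
      have h' : ∑ j : Fin m, l1norm (EuclideanSpace.single j.succ.succ ((1 / 4) ^ (j.val + 1)) :
          Euc (m + 2)) = ∑ j : Fin m, (1 / 4 : ℝ) ^ (j.val + 1) :=
        Finset.sum_congr rfl fun j _ => by rw [l1norm_single, abs_of_pos (by positivity)]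
      rw [h'] at h
      rw [l1norm_single, abs_of_pos (by norm_num)]
      linarith [sum_quarter_pow_le m]
    · simp only [chainVec, l1norm_single]
      norm_num

theorem forall_inner_chainVec_le_one_iff {m : ℕ} (x : Euc (m + 2)) :
    (∀ i, ⟪chainVec m i, x⟫ ≤ 1) ↔
      (∀ j : Fin m, x j.succ.succ ≤ 3 + 2 * x j.castSucc.succ) ∧
      (∀ j : Fin m, x j.succ.succ ≤ 3 - 2 * x j.castSucc.succ) ∧
      -3 ≤ x (Fin.last (m + 1)) ∧
      x 0 ≤ 2 + 2 * ∑ j : Fin m, (1 / 4) ^ (j.val + 1) * x j.succ.succ ∧ -1 ≤ x 0 := by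
  simp only [Sum.forall, Fin.forall_fin_succ, Fin.forall_fin_zero, chainVec, inner_sub_left,
    inner_add_left, sum_inner, EuclideanSpace.inner_single_left, conj_trivial, and_true,
    Fin.succ_zero_eq_one, Fin.succ_one_eq_two]
  refine and_congr (forall_congr' fun j => ?_) (and_congr (forall_congr' fun j => ?_)
    (and_congr ?_ (and_congr ?_ ?_))) <;> constructor <;> intro h <;> linarith

theorem bounds_of_inner_chainVec_le_one {m : ℕ} (hm : 1 ≤ m) {x : Euc (m + 2)}
    (hx : ∀ i, ⟪chainVec m i, x⟫ ≤ 1) :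
    (∀ k, |x k| ≤ 4) ∧ x 0 ≤ 3 - x 1 ^ 2 / 3 + 2 * (1 / 4) ^ m := by
  obtain ⟨h1, h2, h3, h4, h5⟩ := (forall_inner_chainVec_le_one_iff x).1 hx
  have hlast : |x (Fin.last m).succ| ≤ 3 := by
    obtain ⟨m, rfl⟩ := Nat.exists_eq_add_of_le' hm
    have h1' := h1 (Fin.last m)
    have h2' := h2 (Fin.last m)
    simp only [Fin.succ_last] at h1' h2' ⊢
    exact abs_le.2 ⟨h3, by simp only [Nat.succ_eq_add_one] at *; linarith⟩
  obtain ⟨hb, hs⟩ := sum_tent_le (fun j => x j.succ) h1 h2 hlast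
  have hx0 : x 0 ≤ 3 - x 1 ^ 2 / 3 + 2 * (1 / 4) ^ m := by
    have : x (Fin.succ 0) = x 1 := rfl
    simp only [this] at hs
    linarith
  refine ⟨fun k => Fin.cases ?_ (fun j => (hb j).trans (by norm_num)) k, hx0⟩
  have hpow : (1 / 4 : ℝ) ^ m ≤ 1 / 4 := by
    simpa using pow_le_pow_of_le_one (by norm_num : (0 : ℝ) ≤ 1 / 4) (by norm_num) hm
  exact abs_le.2 ⟨by linarith, by nlinarith [sq_nonneg (x 1)]⟩

theorem exists_chain_point (m : ℕ) {s : ℝ} (hs : |s| ≤ 2) :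
    ∃ x : Euc (m + 2), (∀ i, ⟪chainVec m i, x⟫ ≤ 1) ∧ x 1 = s ∧
      3 - s ^ 2 / 3 - (1 / 4) ^ m ≤ x 0 := by
  have hs3 : |s| ≤ 3 := hs.trans (by norm_num)
  have hs2 : s ^ 2 ≤ 4 := by
    have := sq_le_sq' (abs_le.1 hs).1 (abs_le.1 hs).2
    linarith
  have hsum := sum_tent_iterate s m
  set S := ∑ j ∈ Finset.range m, (1 / 4 : ℝ) ^ (j + 1) * tent^[j + 1] s with hS
  set x : Euc (m + 2) := WithLp.toLp 2
    (Fin.cons (2 + 2 * S) fun j : Fin (m + 1) => tent^[j.val] s) with hx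
  have hx0 : x 0 = 2 + 2 * S := rfl
  have hxs : ∀ j : Fin (m + 1), x j.succ = tent^[j.val] s := fun j => rfl
  have hlow : 3 - s ^ 2 / 3 - (1 / 4) ^ m ≤ x 0 := by
    rw [hx0, hsum]
    have h1 : (0 : ℝ) ≤ (1 / 4) ^ m := by positivity
    nlinarith [mul_nonneg h1 (sq_nonneg (tent^[m] s))]
  have hstep : ∀ j : Fin m, x j.succ.succ = 3 - 2 * |x j.castSucc.succ| := by
    intro j
    rw [hxs, hxs, Fin.val_succ, Function.iterate_succ_apply', tent, Fin.val_castSucc]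
  refine ⟨x, (forall_inner_chainVec_le_one_iff x).2 ⟨fun j => ?_, fun j => ?_, ?_, ?_, ?_⟩,
    rfl, hlow⟩
  · rw [hstep]
    linarith [neg_abs_le (x j.castSucc.succ)]
  · rw [hstep]
    linarith [le_abs_self (x j.castSucc.succ)]
  · rw [← Fin.succ_last, hxs]
    exact (abs_le.1 (abs_tent_iterate_le hs3 _)).1
  · rw [hx0, hS, ← Fin.sum_univ_eq_sum_range (fun j => (1 / 4 : ℝ) ^ (j + 1) * tent^[j + 1] s)]
    rfl
  · have : (1 / 4 : ℝ) ^ m ≤ 1 := pow_le_one₀ (by norm_num) (by norm_num)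
    linarith

theorem inner_single_add_smul_single {m : ℕ} (x : Euc (m + 2)) (s : ℝ) :
    ⟪x, (EuclideanSpace.single 0 1 + s • EuclideanSpace.single 1 1 : Euc (m + 2))⟫ =
      x 0 + s * x 1 := by
  simp [inner_add_right, inner_smul_right, EuclideanSpace.inner_single_right]

theorem linearIndependent_single_zero_one (m : ℕ) :
    LinearIndependent ℝ
      ![(EuclideanSpace.single 0 1 : Euc (m + 2)), EuclideanSpace.single 1 1] := by
  refine LinearIndependent.pair_iff.2 fun s t h => ?_
  have h0 := congrArg (fun x : Euc (m + 2) => x 0) h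
  have h1 := congrArg (fun x : Euc (m + 2) => x 1) h
  simp at h0 h1
  exact ⟨h0, h1⟩

theorem finrank_span_single_zero_one (m : ℕ) :
    Module.finrank ℝ (Submodule.span ℝ
      {(EuclideanSpace.single 0 1 : Euc (m + 2)), EuclideanSpace.single 1 1}) = 2 := by
  have h := finrank_span_eq_card (linearIndependent_single_zero_one m)
  rwa [Matrix.range_cons, Matrix.range_cons, Matrix.range_empty, union_empty,
    ← Set.insert_eq, Fintype.card_fin] at h

theorem exists_surjective_of_card_le {n : ℕ} {ι : Type*} [Fintype ι] [Nonempty ι]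
    (h : Fintype.card ι ≤ n) : ∃ f : Fin n → ι, Function.Surjective f := by
  obtain ⟨e⟩ := Function.Embedding.nonempty_of_card_le (α := ι) (β := Fin n) (by simpa using h)
  exact ⟨Function.invFun e, Function.invFun_surjective e.injective⟩

/-- Maximizers over the perturbed chain polytope in a direction normal to the parabola lie close to
the corresponding tangent point. -/
theorem sq_sub_le_of_isPolarMax {m n : ℕ} (hm : 1 ≤ m) {a b : Fin n → Euc (m + 2)}
    (ha : ∀ x, x ∈ polarSet a ↔ ∀ i, ⟪chainVec m i, x⟫ ≤ 1) {δ : ℝ} (hδ0 : 0 ≤ δ)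
    (hδ1 : δ ≤ 1 / 8) (hδ : ∀ i, l1norm (b i - a i) ≤ δ) {s : ℝ} (hs : s ∈ Icc (0 : ℝ) 1)
    {x : Euc (m + 2)}
    (hx : IsPolarMax b (EuclideanSpace.single 0 1 + s • EuclideanSpace.single 1 1) x) :
    ((1 + δ * 8)⁻¹ * x 1 - 3 / 2 * s) ^ 2 ≤ 9 * (1 / 4) ^ m + 210 * δ := by
  obtain ⟨hs0, hs1⟩ := hs
  have hbound : ∀ y ∈ polarSet a, ∀ k, |y k| ≤ 4 := fun y hy =>
    (bounds_of_inner_chainVec_le_one hm ((ha y).1 hy)).1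
  have hx8 : ∀ k, |x k| ≤ 8 := fun k => by
    have := abs_le_of_mem_polarSet_perturbed hδ hδ0 (by linarith) hbound hx.1 k
    linarith
  have hδ' : ∀ i, l1norm (a i - b i) ≤ δ := fun i => by
    have : l1norm (a i - b i) = l1norm (b i - a i) := by simp [l1norm, abs_sub_comm]
    exact this ▸ hδ i
  obtain ⟨x', hx', hx'1, hx'0⟩ := exists_chain_point m (s := 3 / 2 * s)
    (abs_le.2 ⟨by linarith, by linarith⟩)
  have hmax := hx.2 _ (inv_smul_mem_polarSet hδ hδ0 (by norm_num) ((ha x').2 hx')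
    (hbound x' ((ha x').2 hx')))
  have hy := (bounds_of_inner_chainVec_le_one hm ((ha _).1
    (inv_smul_mem_polarSet hδ' hδ0 (by norm_num) hx.1 hx8))).2
  rw [inner_smul_left, inner_single_add_smul_single, inner_single_add_smul_single,
    conj_trivial, inv_mul_le_iff₀ (by positivity)] at hmax
  simp only [PiLp.smul_apply, smul_eq_mul] at hy
  have hx0 : x 0 = (1 + δ * 8) * ((1 + δ * 8)⁻¹ * x 0) := by field_simp
  have hx1 : x 1 = (1 + δ * 8) * ((1 + δ * 8)⁻¹ * x 1) := by field_simp
  set y0 := (1 + δ * 8)⁻¹ * x 0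
  set y1 := (1 + δ * 8)⁻¹ * x 1
  set e := (1 / 4 : ℝ) ^ m with he
  have he0 : 0 ≤ e := by positivity
  have he1 : e ≤ 1 / 4 := by
    rw [he]
    simpa using pow_le_pow_of_le_one (by norm_num : (0 : ℝ) ≤ 1 / 4) (by norm_num) hm
  rw [hx0, hx1, hx'1] at hmax
  set H := 3 + 3 / 4 * s ^ 2 with hH
  set g := (y1 - 3 / 2 * s) ^ 2 with hg
  have hs2 : s ^ 2 ≤ 1 := pow_le_one₀ hs0 hs1
  have hval : y0 + s * y1 ≤ H + 2 * e - g / 3 := by rw [hH, hg]; nlinarith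
  have hlow : H - e ≤ (1 + δ * 4) * (1 + δ * 8) * (y0 + s * y1) := by rw [hH]; nlinarith
  have hg0 : 0 ≤ g := sq_nonneg _
  have hpos : 0 ≤ y0 + s * y1 := by
    by_contra hneg
    push Not at hneg
    have : 0 < (1 + δ * 4) * (1 + δ * 8) := by positivity
    nlinarith [sq_nonneg s]
  have hprod : (1 + δ * 4) * (1 + δ * 8) ≤ 1 + 16 * δ := by nlinarith
  have h1 : H - e ≤ (1 + 16 * δ) * (y0 + s * y1) :=
    hlow.trans (mul_le_mul_of_nonneg_right hprod hpos)
  have h2 : y0 + s * y1 ≤ 17 / 4 := by linarith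
  nlinarith

/-- The vectors of a simplex with the origin in its interior. -/
def simplexVec (d : ℕ) : Option (Fin d) → Euc d
  | none => ∑ k, EuclideanSpace.single k (1 / d : ℝ)
  | some k => EuclideanSpace.single k (-1)

theorem l1norm_simplexVec_le (d : ℕ) (i : Option (Fin d)) : l1norm (simplexVec d i) ≤ 1 := by
  rcases i with _ | k
  · refine (l1norm_sum_le _ _).trans ?_
    simp only [l1norm_single, Finset.sum_const, Finset.card_univ, Fintype.card_fin, nsmul_eq_mul]
    rw [abs_of_nonneg (by positivity), one_div]
    exact mul_inv_le_one
  · simp [simplexVec, l1norm_single]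

theorem abs_le_of_inner_simplexVec_le_one {d : ℕ} {x : Euc d}
    (hx : ∀ i, ⟪simplexVec d i, x⟫ ≤ 1) (k : Fin d) : |x k| ≤ 2 * d := by
  have hd : (1 : ℝ) ≤ d := by exact_mod_cast k.pos
  have hlow : ∀ k, -1 ≤ x k := fun k => by
    have := hx (some k)
    simp only [simplexVec, EuclideanSpace.inner_single_left, conj_trivial] at this
    linarith
  have hsum : ∑ k, x k ≤ d := by
    have := hx none
    simp only [simplexVec, sum_inner, EuclideanSpace.inner_single_left, conj_trivial,
      ← Finset.mul_sum] at this
    rw [one_div, inv_mul_le_iff₀ (by positivity), mul_one] at this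
    exact this
  have hk : x k + 1 ≤ ∑ j, (x j + 1) :=
    Finset.single_le_sum (f := fun j => x j + 1) (fun j _ => by linarith [hlow j])
      (Finset.mem_univ k)
  rw [Finset.sum_add_distrib] at hk
  simp only [Finset.sum_const, Finset.card_univ, Fintype.card_fin, nsmul_eq_mul, mul_one] at hk
  exact abs_le.2 ⟨by linarith [hlow k], by linarith⟩

/-- The number of edges obtained for the chain polytope under perturbations of size `δ`. -/
theorem exists_chain_family {m n : ℕ} (hm : 1 ≤ m) (hn : 2 * m + 3 ≤ n) :
    ∃ a : Fin n → Euc (m + 2), (∀ i, l1norm (a i) ≤ 1) ∧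
      ∀ δ : ℝ, 0 ≤ δ → δ ≤ 1 / 8 → ∀ b : Fin n → Euc (m + 2), (∀ i, l1norm (b i - a i) ≤ δ) →
      ∀ N : ℕ, (N ≤ 1 ∨ 64 * (N : ℝ) ^ 2 * (9 * (1 / 4) ^ m + 210 * δ) < 9) →
      N ≤ edgeCount (convexHull ℝ (range b) ∩ (Submodule.span ℝ
        {(EuclideanSpace.single 0 1 : Euc (m + 2)), EuclideanSpace.single 1 1} :
          Submodule ℝ (Euc (m + 2)))) := by
  obtain ⟨f, hf⟩ := exists_surjective_of_card_le (ι := Fin m ⊕ Fin m ⊕ Fin 3) (n := n)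
    (by simp only [Fintype.card_sum, Fintype.card_fin]; omega)
  refine ⟨chainVec m ∘ f, fun i => l1norm_chainVec_le m _, fun δ hδ0 hδ1 b hδ N hN => ?_⟩
  have ha : ∀ x, x ∈ polarSet (chainVec m ∘ f) ↔ ∀ i, ⟪chainVec m i, x⟫ ≤ 1 := fun x =>
    (hf.forall (p := fun i => ⟪chainVec m i, x⟫ ≤ 1)).symm
  have hbound : ∀ x ∈ polarSet b, ‖x‖ ≤ (m + 2 : ℕ) * (2 * 4) := fun x hx =>
    norm_le_of_forall_abs_le (by norm_num) (abs_le_of_mem_polarSet_perturbed hδ hδ0 (by linarith)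
      (fun y hy => (bounds_of_inner_chainVec_le_one hm ((ha y).1 hy)).1) hx)
  refine le_edgeCount (by omega) hbound (linearIndependent_single_zero_one m)
    (hN.imp_right fun hN s hs s' hs' x hx hx' => ?_)
  have h := sq_sub_le_of_isPolarMax hm ha hδ0 hδ1 hδ hs hx
  have h' := sq_sub_le_of_isPolarMax hm ha hδ0 hδ1 hδ hs' hx'
  set ρ := 9 * (1 / 4 : ℝ) ^ m + 210 * δ
  have hsq : 9 * (s - s') ^ 2 ≤ 16 * ρ := by
    nlinarith [sq_nonneg (((1 + δ * 8)⁻¹ * x 1 - 3 / 2 * s) + ((1 + δ * 8)⁻¹ * x 1 - 3 / 2 * s'))]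
  rw [← sq_lt_one_iff₀ (by positivity), mul_pow, sq_abs]
  nlinarith [mul_le_mul_of_nonneg_right hsq (sq_nonneg (N : ℝ))]

theorem exists_simplex_family {m n : ℕ} (hn : m + 3 ≤ n) :
    ∃ a : Fin n → Euc (m + 2), (∀ i, l1norm (a i) ≤ 1) ∧
      ∀ δ : ℝ, 0 ≤ δ → δ * (2 * (m + 2 : ℕ)) ≤ 1 / 2 →
      ∀ b : Fin n → Euc (m + 2), (∀ i, l1norm (b i - a i) ≤ δ) →
      1 ≤ edgeCount (convexHull ℝ (range b) ∩ (Submodule.span ℝ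
        {(EuclideanSpace.single 0 1 : Euc (m + 2)), EuclideanSpace.single 1 1} :
          Submodule ℝ (Euc (m + 2)))) := by
  obtain ⟨f, hf⟩ := exists_surjective_of_card_le (ι := Option (Fin (m + 2))) (n := n)
    (by simp only [Fintype.card_option, Fintype.card_fin]; omega)
  refine ⟨simplexVec _ ∘ f, fun i => l1norm_simplexVec_le _ _, fun δ hδ0 hδ1 b hδ => ?_⟩
  have hbound : ∀ x ∈ polarSet b, ‖x‖ ≤ (m + 2 : ℕ) * (2 * (2 * (m + 2 : ℕ))) := fun x hx =>
    norm_le_of_forall_abs_le (by positivity) (abs_le_of_mem_polarSet_perturbed hδ hδ0 hδ1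
      (fun y hy => abs_le_of_inner_simplexVec_le_one
        ((hf.forall (p := fun i => ⟪simplexVec _ i, y⟫ ≤ 1)).2 hy)) hx)
  exact le_edgeCount (by omega) hbound (linearIndependent_single_zero_one m) (.inl le_rfl)

/-- Deterministic form of the lower bound, for perturbations in Euclidean balls. -/
theorem exists_family_le_edgeCount {m : ℕ} (hm : 4 ≤ m) {σ : ℝ} (hσ : 0 < σ)
    (hσ' : σ ≤ 1 / (360 * (m + 2 : ℕ) * Real.sqrt (Real.log (4 * (m + 2) - 15 : ℕ)))) :
    ∃ a : Fin (4 * (m + 2) - 15) → Euc (m + 2), (∀ i, l1norm (a i) ≤ 1) ∧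
      ∀ ω : Fin (4 * (m + 2) - 15) → Euc (m + 2),
      (∀ i, ω i ∈ Metric.closedBall (a i) (5 * (Real.sqrt (m + 2 : ℕ) * σ))) →
      1 / 200 * min (1 / Real.sqrt ((m + 2 : ℕ) * σ *
          Real.sqrt (Real.log (4 * (m + 2) - 15 : ℕ)))) (2 ^ (m + 2)) ≤
        (edgeCount (convexHull ℝ (range ω) ∩ (Submodule.span ℝ
          {(EuclideanSpace.single 0 1 : Euc (m + 2)), EuclideanSpace.single 1 1} :
            Submodule ℝ (Euc (m + 2)))) : ℝ) := by
  set n := 4 * (m + 2) - 15 with hn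
  set L := Real.sqrt (Real.log (n : ℕ)) with hL
  have hL1 : 1 ≤ L := by
    have h9 : (9 : ℝ) ≤ n := by exact_mod_cast (by omega : 9 ≤ n)
    rw [hL, Real.one_le_sqrt, Real.le_log_iff_exp_le (by linarith)]
    linarith [Real.exp_one_lt_d9]
  set D : ℝ := ((m + 2 : ℕ) : ℝ) with hD
  have hD0 : 0 < D := by positivity
  set τ := D * σ * L with hτ
  have hτ0 : 0 < τ := by positivity
  have hτ1 : τ ≤ 1 / 360 := by
    rw [le_div_iff₀ (by positivity)] at hσ'
    rw [hτ, le_div_iff₀ (by norm_num)]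
    linarith
  set δ := 5 * (D * σ) with hδ
  have hδ0 : 0 ≤ δ := by positivity
  have hδτ : δ ≤ 5 * τ := by
    rw [hδ, hτ]
    have : D * σ * 1 ≤ D * σ * L := by gcongr
    linarith
  have hpert : ∀ a ω : Fin n → Euc (m + 2),
      (∀ i, ω i ∈ Metric.closedBall (a i) (5 * (Real.sqrt D * σ))) →
      ∀ i, l1norm (ω i - a i) ≤ δ := by
    intro a ω h i
    have hi := h i
    rw [Metric.mem_closedBall, dist_eq_norm] at hi
    calc l1norm (ω i - a i) ≤ Real.sqrt D * ‖ω i - a i‖ := l1norm_le_sqrt_mul_norm _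
      _ ≤ Real.sqrt D * (5 * (Real.sqrt D * σ)) := by gcongr
      _ = 5 * (Real.sqrt D * Real.sqrt D * σ) := by ring
      _ = δ := by rw [Real.mul_self_sqrt hD0.le]
  set μ := min (1 / Real.sqrt τ) (2 ^ (m + 2)) with hμ
  have hμ0 : 0 < μ := lt_min (by positivity) (by positivity)
  rcases hm.eq_or_lt with h4 | h5
  · obtain ⟨a, ha, hedge⟩ := exists_simplex_family (m := m) (n := n) (by omega)
    refine ⟨a, ha, fun ω hω => ?_⟩
    have h6 : D = 6 := by rw [hD, ← h4]; norm_num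
    have h := hedge δ hδ0 (by rw [← hD, h6]; linarith) ω (hpert a ω hω)
    have hμ64 : μ ≤ 64 := (min_le_right _ _).trans_eq (by rw [← h4]; norm_num)
    have h' := (Nat.one_le_cast (α := ℝ)).2 h
    linarith
  · obtain ⟨a, ha, hedge⟩ := exists_chain_family (m := m) (n := n) (by omega) (by omega)
    refine ⟨a, ha, fun ω hω => ?_⟩
    refine (Nat.le_ceil _).trans (Nat.cast_le.2
      (hedge δ hδ0 (by linarith) ω (hpert a ω hω) _ ?_))
    rcases le_or_gt (1 / 200 * μ) 1 with hle | hgt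
    · exact .inl (Nat.ceil_le.2 (by exact_mod_cast hle))
    · right
      have hN : (⌈1 / 200 * μ⌉₊ : ℝ) ≤ 1 / 100 * μ := by
        linarith [Nat.ceil_lt_add_one (by linarith : 0 ≤ 1 / 200 * μ)]
      have hμτ : μ ^ 2 * τ ≤ 1 := by
        have h1 : μ ^ 2 ≤ (1 / Real.sqrt τ) ^ 2 := by
          gcongr
          exact min_le_left _ _
        rw [div_pow, Real.sq_sqrt hτ0.le, one_pow, le_div_iff₀ hτ0] at h1
        exact h1
      have hμd : μ ^ 2 * (1 / 4) ^ m ≤ 16 := by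
        have h1 : μ ^ 2 ≤ (2 ^ (m + 2)) ^ 2 := by
          gcongr
          exact min_le_right _ _
        calc μ ^ 2 * (1 / 4) ^ m ≤ (2 ^ (m + 2)) ^ 2 * (1 / 4) ^ m := by gcongr
          _ = 16 * (4 * (1 / 4)) ^ m := by
            rw [← pow_mul, mul_comm (m + 2), pow_mul, pow_add, mul_pow]
            norm_num
            ring
          _ = 16 := by norm_num
      calc 64 * (⌈1 / 200 * μ⌉₊ : ℝ) ^ 2 * (9 * (1 / 4) ^ m + 210 * δ)
          ≤ 64 * (1 / 100 * μ) ^ 2 * (9 * (1 / 4) ^ m + 210 * (5 * τ)) := by gcongr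
        _ = 64 / 10000 * (9 * (μ ^ 2 * (1 / 4) ^ m) + 1050 * (μ ^ 2 * τ)) := by ring
        _ < 9 := by linarith

/-- smoothed complexity lower bound.
There is a universal `c > 0` such that for every `d ≥ 5`, `n = 4d - 15` and
`0 < σ ≤ 1/(360 d √(log n))`, there are a two-dimensional subspace `W ⊆ ℝ^d` and points
`ā₁,…,ā_n` of `ℓ₁` norm at most `1` such that, for independent `a_i ∼ N(ā_i, σ² I_d)`,
with probability at least `1 - (n choose d)⁻¹` the polygon `conv(a₁,…,a_n) ∩ W` has at
least `c · min(1/√(d σ √(log n)), 2^d)` edges. -/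
theorem stmt_19 :
    ∃ c : ℝ, 0 < c ∧
      ∀ d : ℕ, 5 ≤ d →
      ∀ σ : ℝ, 0 < σ →
        σ ≤ 1 / (360 * d * Real.sqrt (Real.log (4 * d - 15 : ℕ))) →
      ∃ W : Submodule ℝ (Euc d), Module.finrank ℝ W = 2 ∧
      ∃ abar : Fin (4 * d - 15) → Euc d,
        (∀ i, l1norm (abar i) ≤ 1) ∧
        1 - ((((4 * d - 15).choose d) : ℝ≥0∞))⁻¹ ≤
          jointGaussian (4 * d - 15) d abar σ
            {ω | c * min (1 / Real.sqrt (d * σ * Real.sqrt (Real.log (4 * d - 15 : ℕ))))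
                (2 ^ d) ≤
              (edgeCount (convexHull ℝ (Set.range ω) ∩ ↑W) : ℝ)} := by
  refine ⟨1 / 200, by norm_num, fun d hd σ hσ hσ' => ?_⟩
  obtain ⟨m, rfl⟩ := Nat.exists_eq_add_of_le' (show 2 ≤ d by omega)
  refine ⟨_, finrank_span_single_zero_one m, ?_⟩
  rcases (show 3 ≤ m by omega).eq_or_lt with rfl | hm
  · exact ⟨fun _ => 0, fun i => by simp [l1norm], by simp⟩
  · obtain ⟨a, ha, hedge⟩ := exists_family_le_edgeCount hm hσ hσ'
    refine ⟨a, ha, ?_⟩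
    exact (one_sub_inv_choose_le_jointGaussian (by omega) (by omega) (by omega) a hσ).trans
      (measure_mono hedge)
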